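/- For every n ≥ 2 and all nonnegative integers r_1, ..., r_n, the tree S(r_1, ..., r_n) is not integral, i.e., its adjacency matrix has at least one non-integer eigenvalue. -/

import Mathlib

open scoped Classical

/-- Characteristic polynomial of the adjacency matrix of a graph. -/
noncomputable def gCharpoly {V : Type*} [Fintype V] (G : SimpleGraph V) : Polynomial ℝ :=
  letI := Classical.decEq V
  letI := Classical.decRel G.Adj
  (G.adjMatrix ℝ).charpoly

/-- Adjacency eigenvalues listed in non-increasing order (with multiplicity). -/
noncomputable def eigsDesc {V : Type*} [Fintype V] (G : SimpleGraph V) : List ℝ :=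
  ((gCharpoly G).roots.sort (· ≤ ·)).reverse

/-- Number of adjacency eigenvalues in the open interval (-1, 1), with multiplicity. -/
noncomputable def numIn {V : Type*} [Fintype V] (G : SimpleGraph V) : ℕ :=
  ((gCharpoly G).roots.filter (fun x => -1 < x ∧ x < 1)).card

/-- Multiplicity of `lam` as an adjacency eigenvalue. -/
noncomputable def multOf {V : Type*} [Fintype V] (G : SimpleGraph V) (lam : ℝ) : ℕ :=
  (gCharpoly G).roots.count lam

/-- Nullity: dimension of the kernel of the adjacency matrix. -/
noncomputable def gNullity {V : Type*} [Fintype V] (G : SimpleGraph V) : ℕ :=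
  letI := Classical.decRel G.Adj
  Module.finrank ℝ (LinearMap.ker (G.adjMatrix ℝ).mulVecLin)

/-- Base relation for the caterpillar `C(r₁, …, rₙ)`: the path `P_{2n+1}` on
`Fin (2*n+1)` (vertex `vⱼ` of the paper is index `j-1`), with `r i` pendant
vertices attached to `v_{2(i+1)}`, i.e. to index `2*i+1`. -/
def catRel (n : ℕ) (r : Fin n → ℕ) :
    (Fin (2 * n + 1) ⊕ (Σ i : Fin n, Fin (r i))) →
    (Fin (2 * n + 1) ⊕ (Σ i : Fin n, Fin (r i))) → Prop :=
  fun x y =>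
    match x, y with
    | Sum.inl a, Sum.inl b => (a : ℕ) + 1 = (b : ℕ)
    | Sum.inl a, Sum.inr p => (a : ℕ) = 2 * (p.1 : ℕ) + 1
    | _, _ => False

/-- The caterpillar tree `C(r₁, …, rₙ)`. -/
def caterpillar (n : ℕ) (r : Fin n → ℕ) :
    SimpleGraph (Fin (2 * n + 1) ⊕ (Σ i : Fin n, Fin (r i))) :=
  SimpleGraph.fromRel (catRel n r)

/-- Base relation for `S(r₁, …, rₙ)`: the caterpillar `C(r₁, …, rₙ)`, together with
one new pendant vertex at each vertex `v₁, v₃, …, v_{2n+1}` (the odd-indexed path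
vertices, i.e. indices `0, 2, …, 2n`, which include the two degree-one path endpoints),
and one new pendant vertex at each pendant vertex of the caterpillar. -/
def sRel (n : ℕ) (r : Fin n → ℕ) :
    ((Fin (2 * n + 1) ⊕ (Σ i : Fin n, Fin (r i))) ⊕ (Fin (n + 1) ⊕ (Σ i : Fin n, Fin (r i)))) →
    ((Fin (2 * n + 1) ⊕ (Σ i : Fin n, Fin (r i))) ⊕ (Fin (n + 1) ⊕ (Σ i : Fin n, Fin (r i)))) →
    Prop :=
  fun x y =>
    match x, y with
    | Sum.inl a, Sum.inl b => catRel n r a b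
    | Sum.inl (Sum.inl a), Sum.inr (Sum.inl k) => (a : ℕ) = 2 * (k : ℕ)
    | Sum.inl (Sum.inr p), Sum.inr (Sum.inr q) => p = q
    | _, _ => False

/-- The tree `S(r₁, …, rₙ)`. -/
def sTree (n : ℕ) (r : Fin n → ℕ) :
    SimpleGraph ((Fin (2 * n + 1) ⊕ (Σ i : Fin n, Fin (r i))) ⊕
      (Fin (n + 1) ⊕ (Σ i : Fin n, Fin (r i)))) :=
  SimpleGraph.fromRel (sRel n r)

/-- A graph is integral if all of its adjacency eigenvalues are integers. -/
def GraphIntegral {V : Type*} [Fintype V] (G : SimpleGraph V) : Prop :=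
  ∀ x ∈ (gCharpoly G).roots, ∃ z : ℤ, (z : ℝ) = x

lemma mem_roots_of_eigen {V : Type*} [Fintype V] (G : SimpleGraph V) (f : V → ℝ) (l : ℝ)
    (hf : f ≠ 0) (h : ∀ x, ∑ y, (if G.Adj x y then f y else 0) = l * f x) :
    l ∈ (gCharpoly G).roots := by
  unfold gCharpoly
  rw [Polynomial.mem_roots (Matrix.charpoly_monic _).ne_zero, Polynomial.IsRoot.def,
    Matrix.eval_charpoly, ← Matrix.exists_mulVec_eq_zero_iff]
  refine ⟨f, hf, ?_⟩
  funext x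
  have h2 := h x
  rw [Matrix.sub_mulVec]
  simp only [Pi.sub_apply, Pi.zero_apply, Matrix.scalar_apply, Matrix.mulVec_diagonal]
  rw [← h2, sub_eq_zero]
  simp only [Matrix.mulVec, dotProduct, SimpleGraph.adjMatrix_apply]
  refine Finset.sum_congr rfl fun y _ => ?_
  by_cases hy : G.Adj x y <;> simp [hy]

lemma sum_nb (m : ℕ) (F : ℕ → ℝ) (a : ℕ) (ha : a < m) :
    ∑ b : Fin m, (if (a + 1 = (b : ℕ) ∨ (b : ℕ) + 1 = a) then F b else 0)
      = (if a + 1 < m then F (a + 1) else 0) + (if 0 < a then F (a - 1) else 0) := by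
  have h1 : ∀ b : Fin m, (if (a + 1 = (b : ℕ) ∨ (b : ℕ) + 1 = a) then F b else 0)
      = (if a + 1 = (b : ℕ) then F b else 0) + (if (b : ℕ) + 1 = a then F b else 0) := by
    intro b
    by_cases h : a + 1 = (b : ℕ)
    · have : ¬ ((b : ℕ) + 1 = a) := by omega
      simp [h, this]
    · simp [h]
  rw [Finset.sum_congr rfl fun b _ => h1 b, Finset.sum_add_distrib]
  congr 1
  · split_ifs with h
    · rw [Finset.sum_eq_single (⟨a + 1, h⟩ : Fin m)]
      · simp
      · intro b _ hb
        rw [if_neg]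
        intro h'
        exact hb (Fin.ext h'.symm)
      · simp
    · apply Finset.sum_eq_zero
      intro b _
      rw [if_neg]
      have := b.2
      omega
  · split_ifs with h
    · rw [Finset.sum_eq_single (⟨a - 1, by omega⟩ : Fin m)]
      · rw [if_pos]
        show a - 1 + 1 = a
        omega
      · intro b _ hb
        rw [if_neg]
        intro h'
        apply hb
        apply Fin.ext
        show (b : ℕ) = a - 1
        omega
      · simp
    · apply Finset.sum_eq_zero
      intro b _
      rw [if_neg]
      omega

/-- Extension by zero, shifted by one. -/
noncomputable def ext0 {n : ℕ} (c : Fin n → ℝ) (k : ℕ) : ℝ :=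
  if h : 1 ≤ k ∧ k ≤ n then c ⟨k - 1, by omega⟩ else 0

lemma ext0_succ {n : ℕ} (c : Fin n → ℝ) (i : Fin n) : ext0 c (i + 1) = c i := by
  have := i.2
  unfold ext0
  rw [dif_pos (by omega)]
  rfl

lemma ext0_zero {n : ℕ} (c : Fin n → ℝ) : ext0 c 0 = 0 := by
  simp [ext0]

lemma ext0_big {n : ℕ} (c : Fin n → ℝ) (k : ℕ) (hk : n < k) : ext0 c k = 0 := by
  unfold ext0
  rw [dif_neg (by omega)]

/-- Tridiagonal matrix with unit off-diagonal. -/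
noncomputable def triM {n : ℕ} (d : Fin n → ℝ) : Matrix (Fin n) (Fin n) ℝ :=
  fun i j => (if i = j then d i else 0) +
    (if ((i : ℕ) + 1 = (j : ℕ) ∨ (j : ℕ) + 1 = (i : ℕ)) then 1 else 0)

lemma triM_mulVec {n : ℕ} (d : Fin n → ℝ) (c : Fin n → ℝ) (i : Fin n) :
    (triM d).mulVec c i = d i * c i + (ext0 c i + ext0 c (i + 2)) := by
  have h := sum_nb n (fun k => ext0 c (k + 1)) i i.2
  have h2 : (triM d).mulVec c i = ∑ j, (if i = j then d i * c j else 0) +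
    ∑ b : Fin n, (if ((i : ℕ) + 1 = (b : ℕ) ∨ (b : ℕ) + 1 = i) then ext0 c (b + 1) else 0) := by
    rw [← Finset.sum_add_distrib]
    simp only [Matrix.mulVec, dotProduct, triM, ext0_succ]
    refine Finset.sum_congr rfl fun y _ => ?_
    split_ifs <;> ring
  rw [h2, h]
  simp only [Finset.sum_ite_eq, Finset.mem_univ, if_true]
  congr 1
  rw [add_comm]
  congr 1
  · split_ifs with h0
    · congr 1; omega
    · have : (i : ℕ) = 0 := by omega
      rw [this, ext0_zero]
  · split_ifs with h0
    · rfl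
    · rw [ext0_big]; omega

lemma triM_herm {n : ℕ} (d : Fin n → ℝ) : (triM d).IsHermitian := by
  ext i j
  simp only [Matrix.conjTranspose_apply, triM, star_trivial]
  congr 1
  · by_cases h : i = j
    · subst h; simp
    · simp [h, Ne.symm h]
  · congr 1
    exact propext or_comm

lemma triM_row {n : ℕ} (hn : 2 ≤ n) (d : Fin n → ℝ) (i : Fin n) :
    d i ^ 2 + 1 ≤ ∑ k, triM d i k ^ 2 ∧ ∑ k, triM d i k ^ 2 ≤ d i ^ 2 + 2 := by
  have h := sum_nb n (fun k => 1) i i.2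
  have h2 : ∑ k, triM d i k ^ 2 = ∑ j, (if i = j then d i ^ 2 else 0) +
    ∑ b : Fin n, (if ((i : ℕ) + 1 = (b : ℕ) ∨ (b : ℕ) + 1 = i) then 1 else 0) := by
    rw [← Finset.sum_add_distrib]
    refine Finset.sum_congr rfl fun y _ => ?_
    simp only [triM]
    by_cases hy : i = y
    · subst hy
      simp
    · simp [hy]
  rw [h2, h]
  simp only [Finset.sum_ite_eq, Finset.mem_univ, if_true]
  have := i.2
  constructor
  · split_ifs <;> first | (exfalso; omega) | linarith
  · split_ifs <;> linarith

lemma triM_max {n : ℕ} (d : Fin n → ℝ) (c : Fin n → ℝ) (hc : c ≠ 0) (μ : ℝ)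
    (h : (triM d).mulVec c = μ • c) :
    ∃ i, (∀ j, |c j| ≤ |c i|) ∧ 0 < |c i| ∧ |μ - d i| < 2 := by
  obtain ⟨j0, hj0⟩ := Function.ne_iff.mp hc
  obtain ⟨m, -, hm⟩ := Finset.exists_max_image Finset.univ (fun j => |c j|) ⟨j0, Finset.mem_univ _⟩
  have hne : (Finset.univ.filter fun i => |c i| = |c m|).Nonempty := ⟨m, by simp⟩
  obtain ⟨i, hi, himin⟩ := Finset.exists_min_image _ (fun i : Fin n => (i : ℕ)) hne
  simp only [Finset.mem_filter, Finset.mem_univ, true_and] at hi himin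
  have hmax : ∀ j, |c j| ≤ |c i| := fun j => by rw [hi]; exact hm j (Finset.mem_univ _)
  have hpos : 0 < |c i| := lt_of_lt_of_le (abs_pos.mpr hj0) (hmax j0)
  refine ⟨i, hmax, hpos, ?_⟩
  have hE := congrFun h i
  rw [triM_mulVec] at hE
  simp only [Pi.smul_apply, smul_eq_mul] at hE
  have hl : |ext0 c i| < |c i| := by
    unfold ext0
    split_ifs with h1
    · refine lt_of_le_of_ne (hmax _) fun he => ?_
      have := himin _ (he.trans hi)
      simp only at this
      omega
    · simpa using hpos
  have hr : |ext0 c (i + 2)| ≤ |c i| := by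
    unfold ext0
    split_ifs with h1
    · exact hmax _
    · simp
  have h3 : (μ - d i) * c i = ext0 c i + ext0 c (i + 2) := by linarith
  have h4 : |μ - d i| * |c i| < 2 * |c i| := by
    rw [← abs_mul, h3]
    have := abs_add_le (ext0 c i) (ext0 c (i + 2))
    linarith
  exact lt_of_mul_lt_mul_right h4 hpos.le

lemma triM_zero {n : ℕ} (hn : 0 < n) (d : Fin n → ℝ) (c : Fin n → ℝ) (μ : ℝ)
    (h : (triM d).mulVec c = μ • c) (h0 : c ⟨0, hn⟩ = 0) : c = 0 := by
  have key : ∀ k : ℕ, ext0 c k = 0 ∧ ext0 c (k + 1) = 0 := by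
    intro k
    induction k with
    | zero => exact ⟨ext0_zero c, by rw [← h0]; exact ext0_succ c ⟨0, hn⟩⟩
    | succ k ih =>
      refine ⟨ih.2, ?_⟩
      by_cases hk : k < n
      · have hE := congrFun h ⟨k, hk⟩
        rw [triM_mulVec] at hE
        have h5 := ext0_succ c ⟨k, hk⟩
        simp only [Pi.smul_apply, smul_eq_mul] at hE h5
        rw [← h5, ih.1, ih.2] at hE
        show ext0 c (k + 2) = 0
        linarith
      · apply ext0_big; omega
  funext i
  rw [← ext0_succ c i]
  exact (key i).2

/-- Main spectral argument. -/
lemma triM_not_squares {n : ℕ} (hn : 2 ≤ n) (e : Fin n → ℕ)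
    (H : ∀ (c : Fin n → ℝ) (μ : ℝ), c ≠ 0 →
      (triM (fun i => (e i : ℝ) + 3)).mulVec c = μ • c → 1 < μ → ∃ k : ℕ, (k : ℝ) ^ 2 = μ) :
    False := by
  set d : Fin n → ℝ := fun i => (e i : ℝ) + 3 with hd
  have hM := triM_herm d
  set b := hM.eigenvectorBasis with hb
  set lam := hM.eigenvalues with hlam
  have hev : ∀ j, (triM d).mulVec (b j) = lam j • (b j : Fin n → ℝ) :=
    fun j => hM.mulVec_eigenvectorBasis j
  have hcol : ∀ j, ∑ i, b j i ^ 2 = 1 := by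
    intro j
    have := b.orthonormal.1 j
    rw [EuclideanSpace.norm_eq] at this
    have h2 := (Real.sqrt_eq_one).mp this
    simpa using h2
  have hne : ∀ j, (b j : Fin n → ℝ) ≠ 0 := by
    intro j hj
    have := hcol j
    simp [hj] at this
  have hrow : ∀ i k, ∑ j, b j i * b j k = if i = k then 1 else 0 := by
    intro i k
    have hU := (Matrix.mem_unitaryGroup_iff.mp hM.eigenvectorUnitary.2)
    have := congrFun (congrFun hU i) k
    rw [Matrix.mul_apply, Matrix.one_apply] at this
    rw [← this]
    refine Finset.sum_congr rfl fun j _ => ?_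
    simp [Matrix.star_apply, hb]
  have hs0 : ∀ i, ∑ j, b j i ^ 2 = 1 := by
    intro i
    have := hrow i i
    simpa [sq] using this
  have hcomp : ∀ i j, lam j * b j i = ∑ k, triM d i k * b j k := by
    intro i j
    have := congrFun (hev j) i
    simp only [Pi.smul_apply, smul_eq_mul, Matrix.mulVec, dotProduct] at this
    exact this.symm
  have hs1 : ∀ i, ∑ j, lam j * b j i ^ 2 = d i := by
    intro i
    have h1 : ∀ j, lam j * b j i ^ 2 = ∑ k, triM d i k * (b j k * b j i) := by
      intro j
      rw [sq, ← mul_assoc, hcomp, Finset.sum_mul]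
      exact Finset.sum_congr rfl fun k _ => by ring
    simp_rw [h1]
    rw [Finset.sum_comm]
    simp_rw [← Finset.mul_sum, hrow]
    simp [triM]
  have hs2 : ∀ i, ∑ j, lam j ^ 2 * b j i ^ 2 = ∑ k, triM d i k ^ 2 := by
    intro i
    have h1 : ∀ j, lam j ^ 2 * b j i ^ 2
        = ∑ k, ∑ l, triM d i k * triM d i l * (b j k * b j l) := by
      intro j
      rw [← mul_pow, hcomp, sq, Finset.sum_mul_sum]
      exact Finset.sum_congr rfl fun k _ => Finset.sum_congr rfl fun l _ => by ring
    simp_rw [h1]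
    rw [Finset.sum_comm]
    refine Finset.sum_congr rfl fun k _ => ?_
    rw [Finset.sum_comm]
    simp_rw [← Finset.mul_sum, hrow]
    simp [sq]
  have hgt : ∀ j, 1 < lam j := by
    intro j
    obtain ⟨i, -, -, h⟩ := triM_max d _ (hne j) _ (hev j)
    have := (abs_lt.mp h).1
    have h3 : (3 : ℝ) ≤ d i := by simp [hd]
    linarith
  choose k hk using fun j => H _ _ (hne j) (hev j) (hgt j)
  have hk2 : ∀ j, 2 ≤ k j := by
    intro j
    by_contra hcon
    have h1 : (k j : ℝ) ≤ 1 := by exact_mod_cast (by omega : k j ≤ 1)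
    have h2 := hgt j
    rw [← hk j] at h2
    have : (0 : ℝ) ≤ k j := Nat.cast_nonneg _
    nlinarith
  have hinj : Function.Injective k := by
    intro j j' hjj
    by_contra hne'
    have hll : lam j = lam j' := by rw [← hk j, ← hk j', hjj]
    have hn0 : 0 < n := by omega
    set z : Fin n := ⟨0, hn0⟩
    have hv := triM_zero hn0 d (b j' z • (b j : Fin n → ℝ) - b j z • (b j' : Fin n → ℝ)) (lam j)
      (by
        rw [Matrix.mulVec_sub, Matrix.mulVec_smul, Matrix.mulVec_smul, hev, hev, ← hll,
          smul_sub, smul_comm, smul_comm (b j z)])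
      (by simp [z]; ring)
    have horth : ∑ i, b j i * b j' i = 0 := by
      have : inner ℝ (b j) (b j') = 0 := b.orthonormal.2 hne'
      rw [PiLp.inner_apply] at this
      simpa [mul_comm] using this
    have hz : b j' z = 0 := by
      have h6 : ∑ i, (b j' z • (b j : Fin n → ℝ) - b j z • (b j' : Fin n → ℝ)) i * b j i = 0 := by
        rw [hv]; simp
      have h7 : ∑ i, (b j' z • (b j : Fin n → ℝ) - b j z • (b j' : Fin n → ℝ)) i * b j i
          = b j' z * ∑ i, b j i ^ 2 - b j z * ∑ i, b j i * b j' i := by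
        rw [Finset.mul_sum, Finset.mul_sum, ← Finset.sum_sub_distrib]
        refine Finset.sum_congr rfl fun i _ => ?_
        simp only [Pi.sub_apply, Pi.smul_apply, smul_eq_mul]
        ring
      rw [h7, hcol, horth] at h6
      linarith
    exact hne j' (triM_zero hn0 d _ _ (hev j') hz)
  obtain ⟨J, -, hJ⟩ := Finset.exists_max_image Finset.univ k ⟨⟨0, by omega⟩, Finset.mem_univ _⟩
  have hJn : n + 1 ≤ k J := by
    have hsub : Finset.univ.image k ⊆ Finset.Icc 2 (k J) := by
      intro x hx
      obtain ⟨j, -, rfl⟩ := Finset.mem_image.mp hx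
      exact Finset.mem_Icc.mpr ⟨hk2 j, hJ j (Finset.mem_univ _)⟩
    have := Finset.card_le_card hsub
    rw [Finset.card_image_of_injective _ hinj, Nat.card_Icc, Finset.card_univ, Fintype.card_fin]
      at this
    omega
  have hgap : ∀ j, j ≠ J → lam j + (2 * n + 1) ≤ lam J := by
    intro j hj
    have h1 : k j < k J := lt_of_le_of_ne (hJ j (Finset.mem_univ _)) (fun h => hj (hinj h))
    have h2 : (k j : ℝ) + 1 ≤ k J := by exact_mod_cast h1
    have h3 : (n : ℝ) + 1 ≤ k J := by exact_mod_cast hJn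
    have h4 : (0 : ℝ) ≤ k j := Nat.cast_nonneg _
    rw [← hk j, ← hk J]
    nlinarith
  obtain ⟨i, himax, hipos, hid⟩ := triM_max d _ (hne J) _ (hev J)
  obtain ⟨hr1, hr2⟩ := triM_row hn d i
  rw [← hs2] at hr1 hr2
  have hv : ∑ j, (lam j - d i) ^ 2 * b j i ^ 2 = ∑ j, lam j ^ 2 * b j i ^ 2 - d i ^ 2 := by
    have : ∀ j, (lam j - d i) ^ 2 * b j i ^ 2 = lam j ^ 2 * b j i ^ 2
      - 2 * d i * (lam j * b j i ^ 2) + d i ^ 2 * b j i ^ 2 := fun j => by ring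
    simp_rw [this]
    rw [Finset.sum_add_distrib, Finset.sum_sub_distrib, ← Finset.mul_sum, ← Finset.mul_sum, hs0,
      hs1]
    ring
  have hm : ∑ j, (lam j - d i) * b j i ^ 2 = 0 := by
    have : ∀ j, (lam j - d i) * b j i ^ 2 = lam j * b j i ^ 2 - d i * b j i ^ 2 :=
      fun j => by ring
    simp_rw [this]
    rw [Finset.sum_sub_distrib, ← Finset.mul_sum, hs0, hs1]
    ring
  have hnR : (2 : ℝ) ≤ n := by exact_mod_cast hn
  have hgtd : d i < lam J := by
    by_contra hcon
    push Not at hcon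
    have hnp : ∀ j ∈ Finset.univ, (lam j - d i) * b j i ^ 2 ≤ 0 := by
      intro j _
      have : lam j ≤ lam J := by
        by_cases hj : j = J
        · rw [hj]
        · have := hgap j hj
          linarith
      exact mul_nonpos_of_nonpos_of_nonneg (by linarith) (sq_nonneg _)
    have hz := (Finset.sum_eq_zero_iff_of_nonpos hnp).mp hm
    have : ∑ j, (lam j - d i) ^ 2 * b j i ^ 2 = 0 := by
      apply Finset.sum_eq_zero
      intro j hj
      rw [sq, mul_assoc, hz j hj, mul_zero]
    linarith
  have heq : lam J = d i + 1 := by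
    have h1 := (abs_lt.mp hid).2
    rw [← hk J] at h1 hgtd ⊢
    simp only [hd] at h1 hgtd ⊢
    have h2 : k J ^ 2 < e i + 5 := by
      have : (k J : ℝ) ^ 2 < e i + 5 := by linarith
      exact_mod_cast this
    have h3 : e i + 3 < k J ^ 2 := by exact_mod_cast hgtd
    have h4 : k J ^ 2 = e i + 3 + 1 := by omega
    exact_mod_cast h4
  have hf : ∀ j ∈ Finset.univ, (if j = J then (2 * n + 1) * b J i ^ 2 else 0) ≤
      (lam j - d i) ^ 2 * b j i ^ 2 + 2 * n * ((lam j - d i) * b j i ^ 2) := by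
    intro j _
    split_ifs with hj
    · subst hj
      rw [heq]
      apply le_of_eq
      ring
    · have h1 := hgap j hj
      have h2 : (lam j - d i) ^ 2 * b j i ^ 2 + 2 * n * ((lam j - d i) * b j i ^ 2)
        = (d i - lam j) * (d i - 2 * n - lam j) * b j i ^ 2 := by ring
      rw [h2]
      exact mul_nonneg (mul_nonneg (by linarith) (by linarith)) (sq_nonneg _)
  have hsum := Finset.sum_le_sum hf
  rw [Finset.sum_add_distrib, ← Finset.mul_sum, hm, hv] at hsum
  simp only [Finset.sum_ite_eq', Finset.mem_univ, if_true] at hsum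
  have hbig : 1 ≤ n * b J i ^ 2 := by
    rw [← hcol J]
    calc ∑ i, b J i ^ 2 ≤ ∑ _i' : Fin n, b J i ^ 2 :=
          Finset.sum_le_sum fun i' _ => sq_le_sq.mpr (himax i')
      _ = n * b J i ^ 2 := by simp
  have hp : 0 < b J i ^ 2 := by
    rw [← sq_abs]
    positivity
  nlinarith

/-- Lifted eigenvector. -/
noncomputable def lift {n : ℕ} (r : Fin n → ℕ) (c : Fin n → ℝ) (l : ℝ) :
    ((Fin (2 * n + 1) ⊕ (Σ i : Fin n, Fin (r i))) ⊕ (Fin (n + 1) ⊕ (Σ i : Fin n, Fin (r i)))) → ℝ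
  | Sum.inl (Sum.inl a) => if (a : ℕ) % 2 = 0 then l * (ext0 c (a / 2) + ext0 c (a / 2 + 1))
      else (l ^ 2 - 1) * ext0 c (a / 2 + 1)
  | Sum.inl (Sum.inr p) => l * c p.1
  | Sum.inr (Sum.inl k) => ext0 c k + ext0 c (k + 1)
  | Sum.inr (Sum.inr p) => c p.1

lemma lift_eigen {n : ℕ} (r : Fin n → ℕ) (c : Fin n → ℝ) (l : ℝ)
    (h : (triM (fun i => (r i : ℝ) + 3)).mulVec c = (l ^ 2) • c) (x) :
    ∑ y, (if (sTree n r).Adj x y then lift r c l y else 0) = l * lift r c l x := by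
  have hE : ∀ i, ((r i : ℝ) + 3) * c i + (ext0 c i + ext0 c (i + 2)) = l ^ 2 * c i := by
    intro i
    have := congrFun h i
    rwa [triM_mulVec] at this
  rw [Fintype.sum_sum_type, Fintype.sum_sum_type, Fintype.sum_sum_type]
  rcases x with (a | p) | (q | p)
  · have hnb := sum_nb (2 * n + 1) (fun a => if (a : ℕ) % 2 = 0
        then l * (ext0 c (a / 2) + ext0 c (a / 2 + 1))
        else (l ^ 2 - 1) * ext0 c (a / 2 + 1)) a a.2
    have h0 : ∀ b : Fin (2 * n + 1), (if (sTree n r).Adj (Sum.inl (Sum.inl a))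
        (Sum.inl (Sum.inl b)) then lift r c l (Sum.inl (Sum.inl b)) else 0) =
        if ((a : ℕ) + 1 = (b : ℕ) ∨ (b : ℕ) + 1 = (a : ℕ)) then
          (if (b : ℕ) % 2 = 0 then l * (ext0 c (b / 2) + ext0 c (b / 2 + 1))
            else (l ^ 2 - 1) * ext0 c (b / 2 + 1)) else 0 := by
      intro b
      congr 1
      simp only [sTree, SimpleGraph.fromRel_adj, sRel, catRel, ne_eq, Sum.inl.injEq, eq_iff_iff]
      constructor
      · rintro ⟨-, h⟩; exact h
      · intro h
        refine ⟨?_, h⟩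
        rintro rfl
        omega
    have h1 := (Finset.sum_congr rfl fun b _ => h0 b).trans hnb
    rw [h1]
    simp only [sTree, SimpleGraph.fromRel_adj, sRel, catRel, ne_eq, Sum.inl.injEq, reduceCtorEq,
      not_false_eq_true, or_false, true_and, lift, if_false, Finset.sum_const_zero, add_zero]
    rw [Fintype.sum_sigma]
    have ha := a.2
    rcases Nat.even_or_odd' (a : ℕ) with ⟨t, ht | ht⟩
    · have e1 : ∀ i : Fin n, ¬ ((a : ℕ) = 2 * (i : ℕ) + 1) := by intro i; omega
      simp only [e1, if_false, Finset.sum_const_zero, add_zero]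
      rw [Finset.sum_eq_single (⟨t, by omega⟩ : Fin (n + 1))]
      · simp only [ht]
        have e2 : ¬ ((2 * t + 1) % 2 = 0) := by omega
        have e3 : (2 * t + 1) / 2 = t := by omega
        have e4 : (2 * t) % 2 = 0 := by omega
        have e5 : 2 * t / 2 = t := by omega
        simp only [e2, e3, e4, e5, if_true, if_false]
        have e6 : (if 2 * t + 1 < 2 * n + 1 then (l ^ 2 - 1) * ext0 c (t + 1) else 0)
            = (l ^ 2 - 1) * ext0 c (t + 1) := by
          split_ifs with h0
          · rfl
          · rw [ext0_big c (t + 1) (by omega)]; ring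
        have e7 : (if 0 < 2 * t then if (2 * t - 1) % 2 = 0
            then l * (ext0 c ((2 * t - 1) / 2) + ext0 c ((2 * t - 1) / 2 + 1))
            else (l ^ 2 - 1) * ext0 c ((2 * t - 1) / 2 + 1) else 0) = (l ^ 2 - 1) * ext0 c t := by
          split_ifs with h0 h9
          · omega
          · congr 2; omega
          · have : t = 0 := by omega
            rw [this, ext0_zero]; ring
        rw [e6, e7]
        ring
      · intro k _ hk
        rw [if_neg]
        intro h'
        apply hk
        apply Fin.ext
        show (k : ℕ) = t
        omega
      · simp
    · have e1 : ∀ i : Fin (n + 1), ¬ ((a : ℕ) = 2 * (i : ℕ)) := by intro i; omega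
      simp only [e1, if_false, Finset.sum_const_zero, add_zero]
      rw [Finset.sum_eq_single (⟨t, by omega⟩ : Fin n)]
      · simp only [ht]
        have e2 : (2 * t + 1 + 1) % 2 = 0 := by omega
        have e3 : (2 * t + 1 + 1) / 2 = t + 1 := by omega
        have e4 : ¬ ((2 * t + 1) % 2 = 0) := by omega
        have e5 : (2 * t + 1) / 2 = t := by omega
        have e6 : 2 * t + 1 - 1 = 2 * t := by omega
        have e7 : (2 * t) % 2 = 0 := by omega
        have e8 : 2 * t / 2 = t := by omega
        have e9 : 2 * t + 1 + 1 < 2 * n + 1 := by omega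
        have e10 : 0 < 2 * t + 1 := by omega
        simp only [e2, e3, e4, e5, e6, e7, e8, e9, e10, if_true, if_false, Finset.sum_const,
          Finset.card_univ, Fintype.card_fin, nsmul_eq_mul]
        have hh := hE ⟨t, by omega⟩
        have h5 := ext0_succ c ⟨t, by omega⟩
        simp only at hh h5
        rw [← h5] at hh ⊢
        show l * (ext0 c (t + 1) + ext0 c (t + 2)) + _ + _ = _
        linear_combination l * hh
      · intro k _ hk
        apply Finset.sum_eq_zero
        intro _ _
        rw [if_neg]
        intro h'
        apply hk
        apply Fin.ext
        show (k : ℕ) = t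
        omega
      · simp
  · have hp := p.1.2
    simp only [Sum.inl.injEq, sTree, SimpleGraph.fromRel_adj, sRel, catRel, ne_eq, reduceCtorEq,
      not_false_eq_true, or_false, false_or, true_and, and_false, lift, if_false,
      Finset.sum_const_zero, add_zero, zero_add, or_self, Finset.sum_ite_eq, Finset.mem_univ,
      if_true]
    rw [Finset.sum_eq_single (⟨2 * p.1 + 1, by omega⟩ : Fin (2 * n + 1))]
    · have e4 : ¬ ((2 * (p.1 : ℕ) + 1) % 2 = 0) := by omega
      have e5 : (2 * (p.1 : ℕ) + 1) / 2 = p.1 := by omega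
      simp only [e4, e5, if_true, if_false, ext0_succ]
      ring
    · intro k _ hk
      rw [if_neg]
      intro h'
      exact hk (Fin.ext h')
    · simp
  · have hq := q.2
    simp only [sTree, SimpleGraph.fromRel_adj, sRel, catRel, ne_eq, reduceCtorEq,
      not_false_eq_true, or_false, false_or, true_and, and_false, lift, if_false,
      Finset.sum_const_zero, add_zero, zero_add, or_self]
    rw [Finset.sum_eq_single (⟨2 * q, by omega⟩ : Fin (2 * n + 1))]
    · have e4 : (2 * (q : ℕ)) % 2 = 0 := by omega
      have e5 : (2 * (q : ℕ)) / 2 = q := by omega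
      simp only [e4, e5, if_true]
    · intro k _ hk
      rw [if_neg]
      intro h'
      exact hk (Fin.ext h')
    · simp
  · simp only [sTree, SimpleGraph.fromRel_adj, sRel, catRel, ne_eq, reduceCtorEq,
      not_false_eq_true, or_false, false_or, true_and, and_false, lift, if_false,
      Finset.sum_const_zero, add_zero, zero_add, or_self, Finset.sum_ite_eq', Finset.mem_univ,
      if_true]

theorem stmt13 (n : ℕ) (hn : 2 ≤ n) (r : Fin n → ℕ) :
    ¬ GraphIntegral (sTree n r) := by
  intro hI
  refine triM_not_squares hn r fun c μ hc hμ h1 => ?_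
  have hsq : Real.sqrt μ ^ 2 = μ := Real.sq_sqrt (by linarith)
  have hl0 : lift r c (Real.sqrt μ) ≠ 0 := by
    obtain ⟨i, hi⟩ := Function.ne_iff.mp hc
    have hi2 := i.2
    refine Function.ne_iff.mpr ⟨Sum.inl (Sum.inl ⟨2 * i + 1, by omega⟩), ?_⟩
    have e4 : ¬ ((2 * (i : ℕ) + 1) % 2 = 0) := by omega
    have e5 : (2 * (i : ℕ) + 1) / 2 = i := by omega
    simp only [lift, e4, e5, if_false, ext0_succ, hsq]
    exact mul_ne_zero (by linarith) hi
  have hmem := mem_roots_of_eigen (sTree n r) _ (Real.sqrt μ) hl0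
    (lift_eigen r c _ (by rw [hsq]; exact hμ))
  obtain ⟨z, hz⟩ := hI _ hmem
  refine ⟨z.natAbs, ?_⟩
  rw [← hsq, ← hz, Nat.cast_natAbs, Int.cast_abs, sq_abs]
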